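/- For any projection game G, val*(G)² ≤ ‖G‖*² ≤ val*(G). -/

import Mathlib

noncomputable section
open scoped Kronecker ComplexOrder
open Matrix

/-- `d × d` complex matrices. -/
abbrev Mat (d : ℕ) := Matrix (Fin d) (Fin d) ℂ

/-- Entrywise complex conjugation of a matrix. -/
def mconj {m n : Type*} (M : Matrix m n ℂ) : Matrix m n ℂ := M.map (starRingEnd ℂ)

/-- Operator (spectral) norm of a square complex matrix. -/
noncomputable def opNorm {n : Type*} [Fintype n] [DecidableEq n] (M : Matrix n n ℂ) : ℝ :=
  ‖Matrix.toEuclideanCLM (𝕜 := ℂ) M‖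

/-- `⟨ψ| M |ψ⟩`. -/
def braket {ι : Type*} [Fintype ι] (ψ : ι → ℂ) (M : Matrix ι ι ℂ) : ℂ :=
  star ψ ⬝ᵥ M.mulVec ψ

/-- Squared Euclidean norm of a complex vector. -/
def enormSq {ι : Type*} [Fintype ι] (ψ : ι → ℂ) : ℝ := ∑ i, Complex.normSq (ψ i)

/-- A family of psd matrices summing to the identity. -/
def IsPOVM {d : ℕ} {α : Type*} [Fintype α] (M : α → Mat d) : Prop :=
  (∀ a, (M a).PosSemidef) ∧ (∑ a, M a) = 1

/-- A two-player one-round projection game. -/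
structure ProjGame where
  U : Type
  V : Type
  A : Type
  B : Type
  [fU : Fintype U]
  [fV : Fintype V]
  [fA : Fintype A]
  [fB : Fintype B]
  [dA : DecidableEq A]
  μ : U → V → ℝ
  μ_nonneg : ∀ u v, 0 ≤ μ u v
  μ_sum : ∑ u, ∑ v, μ u v = 1
  proj : U → V → B → Option A

attribute [instance] ProjGame.fU ProjGame.fV ProjGame.fA ProjGame.fB ProjGame.dA

namespace ProjGame

variable (G : ProjGame)

/-- Marginal distribution on first-player questions. -/
def μL (u : G.U) : ℝ := ∑ v, G.μ u v

/-- Marginal distribution on second-player questions. -/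
def μR (v : G.V) : ℝ := ∑ u, G.μ u v

/-- Conditional distribution `μ(v|u)`. -/
def μc (u : G.U) (v : G.V) : ℝ := G.μ u v / G.μL u

/-- A `d`-dimensional quantum strategy for the first player. -/
def IsStrategyA {d : ℕ} (A : G.U → G.A → Mat d) : Prop := ∀ u, IsPOVM (A u)

/-- A `d`-dimensional quantum strategy for the second player. -/
def IsStrategyB {d : ℕ} (B : G.V → G.B → Mat d) : Prop := ∀ v, IsPOVM (B v)

/-- Success probability of a pair of quantum strategies with shared state `ψ`. -/
def pay {d : ℕ} (A : G.U → G.A → Mat d) (B : G.V → G.B → Mat d)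
    (ψ : Fin d × Fin d → ℂ) : ℝ :=
  ∑ u, ∑ v, G.μ u v * ∑ a, ∑ b,
    if G.proj u v b = some a then (braket ψ (mconj (A u a) ⊗ₖ B v b)).re else 0

/-- The entangled value `val*(G)`. -/
noncomputable def entVal : ℝ :=
  sSup { x | ∃ (d : ℕ) (A : G.U → G.A → Mat d) (B : G.V → G.B → Mat d)
    (ψ : Fin d × Fin d → ℂ),
    G.IsStrategyA A ∧ G.IsStrategyB B ∧ enormSq ψ = 1 ∧ x = G.pay A B ψ }

/-- The operator `B_u^a = Σ_v μ(v|u) Σ_{b → a} B_v^b`. -/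
def Bop {d : ℕ} (B : G.V → G.B → Mat d) (u : G.U) (a : G.A) : Mat d :=
  ∑ v, ∑ b, if G.proj u v b = some a then (G.μc u v : ℂ) • B v b else 0

/-- The matrix `Σ_u μ(u) Σ_a conj(B_u^a) ⊗ B_u^a`. -/
def sqMat {d : ℕ} (B : G.V → G.B → Mat d) :
    Matrix (Fin d × Fin d) (Fin d × Fin d) ℂ :=
  ∑ u, (G.μL u : ℂ) • ∑ a, mconj (G.Bop B u a) ⊗ₖ G.Bop B u a

/-- The square norm `‖G‖*`. -/
noncomputable def sqNorm : ℝ :=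
  sSup { x | ∃ (d : ℕ) (B : G.V → G.B → Mat d), G.IsStrategyB B ∧
    x = Real.sqrt (opNorm (G.sqMat B)) }

/-- A vector quantum strategy over the finite measured space `Fin n`. -/
def IsVecStrategy {n d : ℕ} (A : Fin n → G.V → G.B → Mat d) : Prop :=
  ∀ i v, (∀ b, (A i v b).PosSemidef) ∧ ((1 : Mat d) - ∑ b, A i v b).PosSemidef

/-- The matrix `E_ω conj(A_{ωv}) ⊗ A_{ωv}` at a fixed `v`. -/
def vecMatAt {n d : ℕ} (w : Fin n → ℝ) (A : Fin n → G.V → G.B → Mat d) (v : G.V) :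
    Matrix (Fin d × Fin d) (Fin d × Fin d) ℂ :=
  ∑ i, (w i : ℂ) • (mconj (∑ b, A i v b) ⊗ₖ (∑ b, A i v b))

/-- The matrix appearing in the definition of `val₊*`. -/
def vecMat {n d : ℕ} (w : Fin n → ℝ) (A : Fin n → G.V → G.B → Mat d) :
    Matrix (Fin d × Fin d) (Fin d × Fin d) ℂ :=
  ∑ i, (w i : ℂ) • ∑ u, (G.μL u : ℂ) • ∑ a, ∑ v, ∑ v',
    ((G.μc u v * G.μc u v' : ℝ) : ℂ) • ∑ b, ∑ b',
      if G.proj u v b = some a ∧ G.proj u v' b' = some a then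
        mconj (A i v b) ⊗ₖ A i v' b' else 0

/-- The relaxed value `val₊*(G)`. -/
noncomputable def valPlus : ℝ :=
  sSup { x | ∃ (n d : ℕ) (w : Fin n → ℝ) (A : Fin n → G.V → G.B → Mat d),
    (∀ i, 0 < w i) ∧ G.IsVecStrategy A ∧
    (∀ v, Real.sqrt (opNorm (G.vecMatAt w A v)) ≤ 1) ∧
    x = opNorm (G.vecMat w A) }

/-- The product of two projection games. -/
def prod (H : ProjGame) : ProjGame where
  U := G.U × H.U
  V := G.V × H.V
  A := G.A × H.A
  B := G.B × H.B
  fU := inferInstance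
  fV := inferInstance
  fA := inferInstance
  fB := inferInstance
  dA := inferInstance
  μ := fun p q => G.μ p.1 q.1 * H.μ p.2 q.2
  μ_nonneg := fun p q => mul_nonneg (G.μ_nonneg _ _) (H.μ_nonneg _ _)
  μ_sum := by
    have h1 := G.μ_sum
    have h2 := H.μ_sum
    calc ∑ p : G.U × H.U, ∑ q : G.V × H.V, G.μ p.1 q.1 * H.μ p.2 q.2
        = ∑ p : G.U × H.U, (∑ v, G.μ p.1 v) * (∑ v', H.μ p.2 v') := by
          refine Finset.sum_congr rfl fun p _ => ?_
          rw [Fintype.sum_prod_type, Finset.sum_mul_sum]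
      _ = (∑ u, ∑ v, G.μ u v) * (∑ u', ∑ v', H.μ u' v') := by
          rw [Fintype.sum_prod_type, Finset.sum_mul_sum]
      _ = 1 := by rw [h1, h2, one_mul]
  proj := fun p q b =>
    (G.proj p.1 q.1 b.1).bind fun a => (H.proj p.2 q.2 b.2).map fun a' => (a, a')

/-- The `k`-fold repetition `G^{⊗k}` (junk value `G` at `k = 0`). -/
def pow : ℕ → ProjGame
  | 0 => G
  | 1 => G
  | (n+2) => G.prod (pow (n+1))

/-- The normalized Laplacian of the square of the constraint graph of `G`. -/
def lap [DecidableEq G.V] : Matrix G.V G.V ℝ :=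
  1 - Matrix.of fun v v' =>
    (Real.sqrt (G.μR v))⁻¹ * (∑ u, G.μL u * G.μc u v * G.μc u v') * (Real.sqrt (G.μR v'))⁻¹

end ProjGame

section MatrixLemmas

variable {ι : Type*} [Fintype ι]

theorem braket_add (ψ : ι → ℂ) (M N : Matrix ι ι ℂ) :
    braket ψ (M + N) = braket ψ M + braket ψ N := by
  simp [braket, Matrix.add_mulVec]

theorem braket_smul (ψ : ι → ℂ) (c : ℂ) (M : Matrix ι ι ℂ) :
    braket ψ (c • M) = c * braket ψ M := by
  simp [braket, Matrix.smul_mulVec]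

/-- `M ↦ ⟨ψ| M |ψ⟩` as a linear map. -/
def braketLin (ψ : ι → ℂ) : Matrix ι ι ℂ →ₗ[ℂ] ℂ where
  toFun := braket ψ
  map_add' := braket_add ψ
  map_smul' := braket_smul ψ

theorem braket_sum (ψ : ι → ℂ) {κ : Type*} (s : Finset κ) (M : κ → Matrix ι ι ℂ) :
    braket ψ (∑ k ∈ s, M k) = ∑ k ∈ s, braket ψ (M k) :=
  map_sum (braketLin ψ) M s

theorem braket_one [DecidableEq ι] (ψ : ι → ℂ) : braket ψ 1 = enormSq ψ := by
  simp [braket, enormSq, dotProduct, Complex.normSq_eq_conj_mul_self]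

theorem braket_re_nonneg (ψ : ι → ℂ) {M : Matrix ι ι ℂ} (hM : M.PosSemidef) :
    0 ≤ (braket ψ M).re :=
  (Complex.nonneg_iff.1 (hM.dotProduct_mulVec_nonneg ψ)).1

theorem inner_toEuclideanCLM_toLp [DecidableEq ι] (ψ : ι → ℂ) (M : Matrix ι ι ℂ) :
    inner ℂ (WithLp.toLp 2 ψ) (Matrix.toEuclideanCLM (𝕜 := ℂ) M (WithLp.toLp 2 ψ))
      = braket ψ M := by
  rw [Matrix.toEuclideanCLM_toLp, EuclideanSpace.inner_toLp_toLp, braket, dotProduct_comm]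

theorem norm_toLp_sq (ψ : ι → ℂ) : ‖WithLp.toLp 2 ψ‖ ^ 2 = enormSq ψ := by
  simp [EuclideanSpace.norm_sq_eq, enormSq, Complex.normSq_eq_norm_sq]

theorem braket_re_le_opNorm [DecidableEq ι] {ψ : ι → ℂ} (hψ : enormSq ψ = 1)
    (M : Matrix ι ι ℂ) : (braket ψ M).re ≤ opNorm M := by
  have h1 : ‖WithLp.toLp 2 ψ‖ = 1 := by
    rw [← pow_eq_one_iff_of_nonneg (norm_nonneg _) two_ne_zero, norm_toLp_sq, hψ]
  rw [← inner_toEuclideanCLM_toLp]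
  refine (Complex.re_le_norm _).trans ((norm_inner_le_norm _ _).trans ?_)
  rw [h1, one_mul]
  simpa [h1, opNorm] using (Matrix.toEuclideanCLM (𝕜 := ℂ) M).le_opNorm (WithLp.toLp 2 ψ)

theorem opNorm_le_of_braket_re_le [DecidableEq ι] {M : Matrix ι ι ℂ} (hM : M.PosSemidef)
    {c : ℝ} (hc : 0 ≤ c) (h : ∀ ψ : ι → ℂ, enormSq ψ = 1 → (braket ψ M).re ≤ c) :
    opNorm M ≤ c := by
  have hsymm : (Matrix.toEuclideanCLM (𝕜 := ℂ) M).IsSymmetric := by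
    have := Matrix.isSymmetric_toEuclideanLin_iff.2 hM.isHermitian
    rwa [← Matrix.coe_toEuclideanCLM_eq_toEuclideanLin] at this
  rw [opNorm, ContinuousLinearMap.norm_eq_iSup_rayleighQuotient _ hsymm]
  refine ciSup_le fun x => ?_
  rcases eq_or_ne x 0 with rfl | hx
  · simpa using hc
  have hx' : ‖x‖ ≠ 0 := norm_ne_zero_iff.2 hx
  have hc0 : ((‖x‖⁻¹ : ℝ) : ℂ) ≠ 0 := by exact_mod_cast inv_ne_zero hx'
  rw [← ContinuousLinearMap.rayleigh_smul _ x hc0]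
  set y : EuclideanSpace ℂ ι := ((‖x‖⁻¹ : ℝ) : ℂ) • x with hy
  have hy1 : ‖y‖ = 1 := by
    rw [hy, norm_smul, Complex.norm_real, norm_inv, norm_norm, inv_mul_cancel₀ hx']
  have hyy : y = WithLp.toLp 2 (WithLp.ofLp y) := rfl
  have hn : enormSq (WithLp.ofLp y) = 1 := by
    rw [← norm_toLp_sq, ← hyy, hy1, one_pow]
  have e : (Matrix.toEuclideanCLM (𝕜 := ℂ) M).rayleighQuotient y
      = (braket (WithLp.ofLp y) M).re := by
    rw [← inner_toEuclideanCLM_toLp, ← hyy, ContinuousLinearMap.rayleighQuotient, hy1,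
      ContinuousLinearMap.reApplyInnerSelf_apply, ← inner_conj_symm]
    simp only [one_pow, div_one, RCLike.re_to_complex, Complex.conj_re]
  rw [e, abs_of_nonneg (braket_re_nonneg _ hM)]
  exact h _ hn

end MatrixLemmas

theorem mconj_eq_transpose {d : ℕ} {M : Mat d} (hM : M.IsHermitian) : mconj M = Mᵀ := by
  ext i j
  exact hM.apply j i

theorem mconj_sum {d : ℕ} {κ : Type*} (s : Finset κ) (M : κ → Mat d) :
    mconj (∑ k ∈ s, M k) = ∑ k ∈ s, mconj (M k) := by
  ext i j
  simp [mconj, Matrix.sum_apply]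

theorem mconj_add {d : ℕ} (M N : Mat d) : mconj (M + N) = mconj M + mconj N := by
  ext i j
  simp [mconj]

theorem posSemidef_mconj_kronecker {d : ℕ} {M N : Mat d} (hM : M.PosSemidef)
    (hN : N.PosSemidef) : (mconj M ⊗ₖ N).PosSemidef := by
  rw [mconj_eq_transpose hM.isHermitian]
  exact hM.transpose.kronecker hN

/-- `N ↦ M ⊗ N` as a linear map. -/
def kronLin {d : ℕ} (M : Mat d) :
    Mat d →ₗ[ℂ] Matrix (Fin d × Fin d) (Fin d × Fin d) ℂ where
  toFun N := M ⊗ₖ N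
  map_add' := Matrix.kronecker_add M
  map_smul' c N := Matrix.kronecker_smul c M N

theorem kronecker_sum_right {d : ℕ} {κ : Type*} (s : Finset κ) (M : Mat d) (N : κ → Mat d) :
    M ⊗ₖ (∑ k ∈ s, N k) = ∑ k ∈ s, M ⊗ₖ N k :=
  map_sum (kronLin M) N s

theorem kronecker_sum_left {d : ℕ} {κ : Type*} (s : Finset κ) (M : κ → Mat d) (N : Mat d) :
    (∑ k ∈ s, M k) ⊗ₖ N = ∑ k ∈ s, M k ⊗ₖ N := by
  ext i j
  simp [Matrix.sum_apply, Finset.sum_mul]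

theorem Matrix.PosSemidef.sum_normSq_row_le {d : ℕ} {M : Mat d} (hM : M.PosSemidef)
    (hM1 : (1 - M).PosSemidef) (i : Fin d) : ∑ j, Complex.normSq (M i j) ≤ (M i i).re := by
  have h : (M - M * M).PosSemidef := by
    have h1 := hM1.conjTranspose_mul_mul_same M
    have h2 := hM.conjTranspose_mul_mul_same (1 - M)
    rw [hM.isHermitian.eq] at h1
    rw [hM1.isHermitian.eq] at h2
    convert h1.add h2 using 1
    noncomm_ring
  have h' := (Complex.nonneg_iff.1 (h.diag_nonneg (i := i))).1
  have e : ((M * M) i i).re = ∑ j, Complex.normSq (M i j) := by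
    rw [Matrix.mul_apply, Complex.re_sum]
    refine Finset.sum_congr rfl fun j _ => ?_
    rw [← hM.isHermitian.apply j i, ← Complex.ofReal_re (Complex.normSq _),
      ← Complex.mul_conj]
    simp
  rw [Matrix.sub_apply, Complex.sub_re, e] at h'
  linarith

theorem IsPOVM.one_sub_posSemidef {d : ℕ} {α : Type*} [Fintype α] {M : α → Mat d}
    (hM : IsPOVM M) (a : α) : (1 - M a).PosSemidef := by
  classical
  have : 1 - M a = ∑ b ∈ Finset.univ.erase a, M b := by
    rw [← hM.2, ← Finset.add_sum_erase _ _ (Finset.mem_univ a), add_sub_cancel_left]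
  rw [this]
  exact Matrix.posSemidef_sum _ fun b _ => hM.1 b

theorem IsPOVM.conj {d : ℕ} {α : Type*} [Fintype α] {M : α → Mat d} (hM : IsPOVM M)
    {V : Mat d} (hV : Vᴴ * V = 1) : IsPOVM fun a => Vᴴ * M a * V :=
  ⟨fun a => (hM.1 a).conjTranspose_mul_mul_same V, by
    rw [← Finset.sum_mul, ← Finset.mul_sum, hM.2, Matrix.mul_one, hV]⟩

theorem IsPOVM.sum_weighted_normSq_le {d : ℕ} {α : Type*} [Fintype α] {M : α → Mat d}
    (hM : IsPOVM M) (s : Fin d → ℝ) :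
    ∑ a, ∑ i, ∑ j, s i * s j * Complex.normSq (M a i j) ≤ ∑ i, s i ^ 2 := by
  have hsymm : ∀ a i j, Complex.normSq (M a j i) = Complex.normSq (M a i j) := fun a i j => by
    rw [← (hM.1 a).isHermitian.apply j i]
    simp
  have hrow : ∀ a, ∑ i, ∑ j, s i * s j * Complex.normSq (M a i j)
      ≤ ∑ i, s i ^ 2 * (M a i i).re := fun a => by
    calc ∑ i, ∑ j, s i * s j * Complex.normSq (M a i j)
        ≤ ∑ i, ∑ j, (s i ^ 2 / 2 * Complex.normSq (M a i j)
            + s j ^ 2 / 2 * Complex.normSq (M a i j)) := by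
          refine Finset.sum_le_sum fun i _ => Finset.sum_le_sum fun j _ => ?_
          nlinarith [Complex.normSq_nonneg (M a i j), sq_nonneg (s i - s j),
            mul_nonneg (sq_nonneg (s i - s j)) (Complex.normSq_nonneg (M a i j))]
      _ = ∑ i, s i ^ 2 * ∑ j, Complex.normSq (M a i j) := by
          simp_rw [Finset.sum_add_distrib]
          rw [Finset.sum_comm (f := fun i j => s j ^ 2 / 2 * Complex.normSq (M a i j))]
          simp_rw [hsymm a, ← Finset.sum_add_distrib, Finset.mul_sum]
          refine Finset.sum_congr rfl fun i _ => Finset.sum_congr rfl fun j _ => ?_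
          rw [hsymm a]
          ring
      _ ≤ _ := Finset.sum_le_sum fun i _ => mul_le_mul_of_nonneg_left
          ((hM.1 a).sum_normSq_row_le (hM.one_sub_posSemidef a) i) (sq_nonneg _)
  refine (Finset.sum_le_sum fun a _ => hrow a).trans_eq ?_
  rw [Finset.sum_comm]
  refine Finset.sum_congr rfl fun i _ => ?_
  rw [← Finset.mul_sum, ← Complex.re_sum, ← Matrix.sum_apply, hM.2]
  simp

theorem braket_vec_mconj_kronecker {d : ℕ} (K A B : Mat d) :
    braket (vec K) (mconj A ⊗ₖ B) = (Kᴴ * (B * K * Aᴴ)).trace := by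
  have : mconj A = (Aᴴ)ᵀ := by ext i j; rfl
  rw [braket, this, Matrix.kronecker_mulVec_vec, Matrix.transpose_transpose,
    Matrix.star_vec_dotProduct_vec]

theorem braket_vec_svd {d : ℕ} (W V : Mat d) (s : Fin d → ℝ) (A B : Mat d) :
    braket (vec (W * diagonal (fun i => (s i : ℂ)) * Vᴴ)) (mconj A ⊗ₖ B)
      = ∑ i, ∑ j, ((s i * s j : ℝ) : ℂ)
          * ((Wᴴ * B * W) i j * star ((Vᴴ * A * V) i j)) := by
  set D : Mat d := diagonal (fun i => (s i : ℂ)) with hD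
  have hDD : Dᴴ = D := by
    rw [hD, diagonal_conjTranspose]
    congr 1
    ext i
    simp
  have e : ((W * D * Vᴴ)ᴴ * (B * (W * D * Vᴴ) * Aᴴ)).trace
      = ((D * (Wᴴ * B * W)) * (D * (Vᴴ * A * V)ᴴ)).trace := by
    simp only [conjTranspose_mul, conjTranspose_conjTranspose, hDD]
    rw [Matrix.mul_assoc V, Matrix.trace_mul_comm V]
    simp only [Matrix.mul_assoc]
  rw [braket_vec_mconj_kronecker, e, Matrix.trace]
  refine Finset.sum_congr rfl fun i _ => ?_
  rw [Matrix.diag_apply, Matrix.mul_apply]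
  refine Finset.sum_congr rfl fun j _ => ?_
  rw [hD, diagonal_mul, diagonal_mul, conjTranspose_apply]
  push_cast
  ring

theorem enormSq_vec_svd {d : ℕ} {W V : Mat d} (hW : Wᴴ * W = 1) (hV : Vᴴ * V = 1)
    (s : Fin d → ℝ) :
    enormSq (vec (W * diagonal (fun i => (s i : ℂ)) * Vᴴ)) = ∑ i, s i ^ 2 := by
  have h := braket_vec_svd W V s 1 1
  have h1 : mconj (1 : Mat d) ⊗ₖ (1 : Mat d) = 1 := by
    rw [mconj_eq_transpose Matrix.isHermitian_one, transpose_one, Matrix.one_kronecker_one]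
  rw [h1, braket_one, Matrix.mul_one, Matrix.mul_one, hW, hV] at h
  have h2 : ∀ i, ∑ j, ((s i * s j : ℝ) : ℂ) * ((1 : Mat d) i j * star ((1 : Mat d) i j))
      = ((s i ^ 2 : ℝ) : ℂ) := fun i => by
    rw [Finset.sum_eq_single i (fun j _ hj => by simp [Matrix.one_apply_ne hj.symm]) (by simp)]
    simp [sq]
  simp_rw [h2] at h
  exact_mod_cast h

/-- Singular value decomposition of a square complex matrix. -/
theorem exists_svd {d : ℕ} (K : Mat d) :
    ∃ (W V : Mat d) (s : Fin d → ℝ), Wᴴ * W = 1 ∧ Vᴴ * V = 1 ∧ (∀ i, 0 ≤ s i) ∧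
      K = W * diagonal (fun i => (s i : ℂ)) * Vᴴ := by
  have hP : (Kᴴ * K).PosSemidef := Matrix.posSemidef_conjTranspose_mul_self K
  let U := hP.isHermitian.eigenvectorUnitary
  let V : Mat d := U
  let ev := hP.isHermitian.eigenvalues
  have hev : ∀ i, 0 ≤ ev i := hP.eigenvalues_nonneg
  have hV : Vᴴ * V = 1 := Unitary.coe_star_mul_self U
  have hV' : V * Vᴴ = 1 := mul_eq_one_comm.1 hV
  have hgram : (K * V)ᴴ * (K * V) = diagonal (fun i => (ev i : ℂ)) := by
    have h := hP.isHermitian.spectral_theorem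
    rw [Unitary.conjStarAlgAut_apply] at h
    calc (K * V)ᴴ * (K * V) = Vᴴ * (Kᴴ * K) * V := by
          rw [conjTranspose_mul]; simp only [Matrix.mul_assoc]
      _ = Vᴴ * (V * diagonal (fun i => (ev i : ℂ)) * Vᴴ) * V := by
          conv_lhs => rw [h]
          rfl
      _ = (Vᴴ * V) * diagonal (fun i => (ev i : ℂ)) * (Vᴴ * V) := by
          simp only [Matrix.mul_assoc]
      _ = _ := by rw [hV, Matrix.one_mul, Matrix.mul_one]
  let s : Fin d → ℝ := fun i => Real.sqrt (ev i)
  have hs2 : ∀ i, s i * s i = ev i := fun i => Real.mul_self_sqrt (hev i)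
  let c : Fin d → EuclideanSpace ℂ (Fin d) := fun i => WithLp.toLp 2 fun j => (K * V) j i
  have hinner : ∀ i j, inner ℂ (c i) (c j) = if i = j then (ev i : ℂ) else 0 := fun i j => by
    have h := congr_fun (congr_fun hgram i) j
    rw [Matrix.diagonal_apply, Matrix.mul_apply] at h
    rw [← h, EuclideanSpace.inner_toLp_toLp, dotProduct_comm]
    rfl
  let S : Set (Fin d) := {i | s i ≠ 0}
  let w : Fin d → EuclideanSpace ℂ (Fin d) := fun i => ((s i)⁻¹ : ℂ) • c i
  have hw : Orthonormal ℂ (S.domRestrict w) := by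
    rw [orthonormal_iff_ite]
    rintro ⟨i, hi⟩ ⟨j, hj⟩
    have hi' : (s i : ℂ) ≠ 0 := by exact_mod_cast hi
    change inner ℂ (((s i)⁻¹ : ℂ) • c i) (((s j)⁻¹ : ℂ) • c j) = _
    simp only [inner_smul_left, inner_smul_right, hinner, Subtype.mk.injEq]
    split_ifs with hij
    · subst hij
      rw [← hs2]
      simp
      field_simp
    · simp
  obtain ⟨b, hb⟩ := hw.exists_orthonormalBasis_extension_of_card_eq (by simp)
  let W : Mat d := Matrix.of fun i j => b j i
  have hW : Wᴴ * W = 1 := by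
    ext i j
    have h := orthonormal_iff_ite.1 b.orthonormal i j
    rw [Matrix.one_apply, ← h, Matrix.mul_apply, PiLp.inner_apply]
    refine Finset.sum_congr rfl fun k _ => ?_
    simp [W, mul_comm]
  refine ⟨W, V, s, hW, hV, fun i => Real.sqrt_nonneg _, ?_⟩
  have hKV : K * V = W * diagonal (fun i => (s i : ℂ)) := by
    ext j i
    rw [Matrix.mul_diagonal]
    change c i j = b i j * (s i : ℂ)
    by_cases hi : s i = 0
    · have h0 : c i = 0 := by
        rw [← inner_self_eq_zero (𝕜 := ℂ), hinner, if_pos rfl, ← hs2, hi]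
        simp
      simp [h0, hi]
    · have hi' : (s i : ℂ) ≠ 0 := by exact_mod_cast hi
      rw [hb i hi]
      simp only [w, PiLp.smul_apply, smul_eq_mul]
      field_simp
  rw [← hKV, Matrix.mul_assoc, hV', Matrix.mul_one]

namespace ProjGame

variable (G : ProjGame)

theorem μL_nonneg (u : G.U) : 0 ≤ G.μL u := Finset.sum_nonneg fun _ _ => G.μ_nonneg _ _

theorem sum_μL : ∑ u, G.μL u = 1 := G.μ_sum

theorem μc_nonneg (u : G.U) (v : G.V) : 0 ≤ G.μc u v :=
  div_nonneg (G.μ_nonneg _ _) (G.μL_nonneg _)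

theorem μL_mul_μc (u : G.U) (v : G.V) : G.μL u * G.μc u v = G.μ u v := by
  by_cases h : G.μL u = 0
  · have := (Finset.sum_eq_zero_iff_of_nonneg fun v _ => G.μ_nonneg u v).1 h v (Finset.mem_univ v)
    rw [h, this, zero_mul]
  · rw [μc, mul_div_cancel₀ _ h]

theorem sum_μc_le_one (u : G.U) : ∑ v, G.μc u v ≤ 1 := by
  simp only [μc]
  rw [← Finset.sum_div]
  exact div_self_le_one (G.μL u)

variable {G} {d : ℕ}

theorem IsStrategyB.bop_posSemidef {B : G.V → G.B → Mat d} (hB : G.IsStrategyB B) (u : G.U)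
    (a : G.A) : (G.Bop B u a).PosSemidef := by
  refine Matrix.posSemidef_sum _ fun v _ => Matrix.posSemidef_sum _ fun b _ => ?_
  split_ifs
  · exact ((hB v).1 b).smul (by exact_mod_cast G.μc_nonneg u v)
  · exact Matrix.PosSemidef.zero

theorem IsStrategyB.one_sub_sum_bop_posSemidef {B : G.V → G.B → Mat d} (hB : G.IsStrategyB B)
    (u : G.U) : (1 - ∑ a, G.Bop B u a).PosSemidef := by
  have hsum : ∀ v b, ∑ a, (if G.proj u v b = some a then (G.μc u v : ℂ) • B v b else 0)
      = (G.μc u v : ℂ) • B v b - if G.proj u v b = none then (G.μc u v : ℂ) • B v b else 0 := by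
    intro v b
    cases h : G.proj u v b <;> simp
  have e : 1 - ∑ a, G.Bop B u a = ((1 - ∑ v, G.μc u v : ℝ) : ℂ) • (1 : Mat d)
      + ∑ v, ∑ b, if G.proj u v b = none then (G.μc u v : ℂ) • B v b else 0 := by
    have h1 : ∑ a, G.Bop B u a = ∑ v, ∑ b, ((G.μc u v : ℂ) • B v b
        - if G.proj u v b = none then (G.μc u v : ℂ) • B v b else 0) := by
      simp only [Bop]
      rw [Finset.sum_comm]
      refine Finset.sum_congr rfl fun v _ => ?_
      rw [Finset.sum_comm]
      exact Finset.sum_congr rfl fun b _ => hsum v b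
    rw [h1]
    simp_rw [Finset.sum_sub_distrib, ← Finset.smul_sum, (hB _).2, ← Finset.sum_smul]
    push_cast
    rw [sub_smul, one_smul]
    abel
  rw [e]
  refine (Matrix.PosSemidef.one.smul ?_).add (Matrix.posSemidef_sum _ fun v _ =>
    Matrix.posSemidef_sum _ fun b _ => ?_)
  · exact_mod_cast sub_nonneg.2 (G.sum_μc_le_one u)
  · split_ifs
    · exact ((hB v).1 b).smul (by exact_mod_cast G.μc_nonneg u v)
    · exact Matrix.PosSemidef.zero

theorem IsStrategyB.sqMat_posSemidef {B : G.V → G.B → Mat d} (hB : G.IsStrategyB B) :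
    (G.sqMat B).PosSemidef :=
  Matrix.posSemidef_sum _ fun u _ => (Matrix.posSemidef_sum _ fun a _ =>
    posSemidef_mconj_kronecker (hB.bop_posSemidef u a) (hB.bop_posSemidef u a)).smul
      (by exact_mod_cast G.μL_nonneg u)

theorem braket_sqMat_re (B : G.V → G.B → Mat d) (ψ : Fin d × Fin d → ℂ) :
    (braket ψ (G.sqMat B)).re
      = ∑ u, G.μL u * ∑ a, (braket ψ (mconj (G.Bop B u a) ⊗ₖ G.Bop B u a)).re := by
  simp only [sqMat, braket_sum, braket_smul, Complex.re_sum, Complex.re_ofReal_mul]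

theorem pay_eq_sum_bop (A : G.U → G.A → Mat d) (B : G.V → G.B → Mat d)
    (ψ : Fin d × Fin d → ℂ) :
    G.pay A B ψ = ∑ u, G.μL u * ∑ a, (braket ψ (mconj (A u a) ⊗ₖ G.Bop B u a)).re := by
  refine Finset.sum_congr rfl fun u _ => ?_
  have h : ∀ a, (braket ψ (mconj (A u a) ⊗ₖ G.Bop B u a)).re = ∑ v, G.μc u v * ∑ b,
      if G.proj u v b = some a then (braket ψ (mconj (A u a) ⊗ₖ B v b)).re else 0 := by
    intro a
    simp only [Bop, kronecker_sum_right, braket_sum, Complex.re_sum, Finset.mul_sum]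
    refine Finset.sum_congr rfl fun v _ => Finset.sum_congr rfl fun b _ => ?_
    split_ifs
    · rw [Matrix.kronecker_smul, braket_smul, Complex.re_ofReal_mul]
    · simp [braket]
  simp_rw [h]
  rw [Finset.sum_comm, Finset.mul_sum]
  refine Finset.sum_congr rfl fun v _ => ?_
  rw [← Finset.mul_sum, ← mul_assoc, μL_mul_μc]

theorem pay_nonneg {A : G.U → G.A → Mat d} {B : G.V → G.B → Mat d}
    (hA : G.IsStrategyA A) (hB : G.IsStrategyB B) (ψ : Fin d × Fin d → ℂ) :
    0 ≤ G.pay A B ψ := by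
  rw [pay_eq_sum_bop]
  exact Finset.sum_nonneg fun u _ => mul_nonneg (G.μL_nonneg u) <| Finset.sum_nonneg fun a _ =>
    braket_re_nonneg _ (posSemidef_mconj_kronecker ((hA u).1 a) (hB.bop_posSemidef u a))

theorem pay_le_one {A : G.U → G.A → Mat d} {B : G.V → G.B → Mat d}
    (hA : G.IsStrategyA A) (hB : G.IsStrategyB B) {ψ : Fin d × Fin d → ℂ}
    (hψ : enormSq ψ = 1) : G.pay A B ψ ≤ 1 := by
  rw [← G.μ_sum]
  refine Finset.sum_le_sum fun u _ => Finset.sum_le_sum fun v _ =>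
    mul_le_of_le_one_right (G.μ_nonneg u v) ?_
  calc _ ≤ ∑ a, ∑ b, (braket ψ (mconj (A u a) ⊗ₖ B v b)).re := by
        refine Finset.sum_le_sum fun a _ => Finset.sum_le_sum fun b _ => ?_
        split_ifs
        · exact le_rfl
        · exact braket_re_nonneg _ (posSemidef_mconj_kronecker ((hA u).1 a) ((hB v).1 b))
    _ = (braket ψ (mconj (∑ a, A u a) ⊗ₖ ∑ b, B v b)).re := by
        simp only [mconj_sum, kronecker_sum_left, kronecker_sum_right, braket_sum, Complex.re_sum]
        exact Finset.sum_comm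
    _ = 1 := by
        rw [(hA u).2, (hB v).2, mconj_eq_transpose Matrix.isHermitian_one, transpose_one,
          Matrix.one_kronecker_one, braket_one, hψ, Complex.ofReal_re]

theorem pay_sq_le_opNorm_sqMat {A : G.U → G.A → Mat d} {B : G.V → G.B → Mat d}
    (hA : G.IsStrategyA A) {ψ : Fin d × Fin d → ℂ}
    (hψ : enormSq ψ = 1) : G.pay A B ψ ^ 2 ≤ opNorm (G.sqMat B) := by
  obtain ⟨W, V, s, hW, hV, hs, hK⟩ := exists_svd (Matrix.of fun i j => ψ (j, i))
  have hψK : ψ = vec (W * diagonal (fun i => (s i : ℂ)) * Vᴴ) := by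
    rw [← hK]; rfl
  have hs1 : ∑ i, s i ^ 2 = 1 := by rw [← enormSq_vec_svd hW hV, ← hψK, hψ]
  set φ := vec (W * diagonal (fun i => (s i : ℂ)) * Wᴴ) with hφ
  have hφ1 : enormSq φ = 1 := by rw [hφ, enormSq_vec_svd hW hW, hs1]
  refine le_trans ?_ (braket_re_le_opNorm hφ1 (G.sqMat B))
  set p := G.pay A B ψ with hp
  let A' : G.U → G.A → Mat d := fun u a => Vᴴ * A u a * V
  let B' : G.U → G.A → Mat d := fun u a => Wᴴ * G.Bop B u a * W
  have hA' : ∀ u, IsPOVM (A' u) := fun u => (hA u).conj hV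
  have hpay : p = ∑ u, G.μL u * ∑ a, ∑ i, ∑ j,
      s i * s j * (B' u a i j * star (A' u a i j)).re := by
    rw [hp, pay_eq_sum_bop, hψK]
    simp only [braket_vec_svd, Complex.re_sum, Complex.re_ofReal_mul, A', B']
  have hsq : (braket φ (G.sqMat B)).re = ∑ u, G.μL u * ∑ a, ∑ i, ∑ j,
      s i * s j * Complex.normSq (B' u a i j) := by
    rw [braket_sqMat_re, hφ]
    simp only [braket_vec_svd, Complex.re_sum, Complex.re_ofReal_mul, B']
    simp only [Complex.star_def, Complex.mul_conj, Complex.ofReal_re]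
  have hAle : ∑ u, G.μL u * ∑ a, ∑ i, ∑ j, s i * s j * Complex.normSq (A' u a i j) ≤ 1 := by
    rw [← G.sum_μL]
    refine Finset.sum_le_sum fun u _ => mul_le_of_le_one_right (G.μL_nonneg u) ?_
    exact ((hA' u).sum_weighted_normSq_le s).trans_eq hs1
  have hpt : ∀ x y : ℂ, 2 * p * (x * star y).re
      ≤ Complex.normSq x + p ^ 2 * Complex.normSq y := fun x y => by
    simp only [Complex.normSq_apply, Complex.star_def, Complex.mul_re, Complex.conj_re,
      Complex.conj_im]
    nlinarith [sq_nonneg (x.re - p * y.re), sq_nonneg (x.im - p * y.im)]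
  have key : 2 * p * p ≤ (braket φ (G.sqMat B)).re + p ^ 2 *
      ∑ u, G.μL u * ∑ a, ∑ i, ∑ j, s i * s j * Complex.normSq (A' u a i j) := by
    conv_lhs => arg 2; rw [hpay]
    rw [hsq]
    simp only [Finset.mul_sum, ← Finset.sum_add_distrib]
    refine Finset.sum_le_sum fun u _ => Finset.sum_le_sum fun a _ =>
      Finset.sum_le_sum fun i _ => Finset.sum_le_sum fun j _ => ?_
    have := mul_le_mul_of_nonneg_left (hpt (B' u a i j) (A' u a i j))
      (mul_nonneg (G.μL_nonneg u) (mul_nonneg (hs i) (hs j)))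
    linarith
  nlinarith [mul_le_mul_of_nonneg_left hAle (sq_nonneg p)]

theorem IsStrategyB.exists_braket_sqMat_le_pay [Nonempty G.A] {B : G.V → G.B → Mat d}
    (hB : G.IsStrategyB B) : ∃ A : G.U → G.A → Mat d, G.IsStrategyA A ∧
      ∀ ψ, (braket ψ (G.sqMat B)).re ≤ G.pay A B ψ := by
  let a₀ : G.A := Classical.arbitrary _
  let R : G.U → G.A → Mat d := fun u a => if a = a₀ then 1 - ∑ a, G.Bop B u a else 0
  have hR : ∀ u a, (R u a).PosSemidef := fun u a => by
    dsimp only [R]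
    split_ifs
    · exact hB.one_sub_sum_bop_posSemidef u
    · exact Matrix.PosSemidef.zero
  refine ⟨fun u a => G.Bop B u a + R u a, fun u =>
    ⟨fun a => (hB.bop_posSemidef u a).add (hR u a), ?_⟩, fun ψ => ?_⟩
  · rw [Finset.sum_add_distrib]
    simp [R]
  · rw [braket_sqMat_re, pay_eq_sum_bop]
    refine Finset.sum_le_sum fun u _ => mul_le_mul_of_nonneg_left
      (Finset.sum_le_sum fun a _ => ?_) (G.μL_nonneg u)
    rw [mconj_add, Matrix.add_kronecker, braket_add, Complex.add_re]
    exact le_add_of_nonneg_right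
      (braket_re_nonneg _ (posSemidef_mconj_kronecker (hR u a) (hB.bop_posSemidef u a)))

variable (G)

theorem entVal_nonneg : 0 ≤ G.entVal := by
  refine Real.sSup_nonneg ?_
  rintro x ⟨d, A, B, ψ, hA, hB, -, rfl⟩
  exact pay_nonneg hA hB ψ

variable {G}

theorem pay_le_entVal {A : G.U → G.A → Mat d} {B : G.V → G.B → Mat d}
    (hA : G.IsStrategyA A) (hB : G.IsStrategyB B) {ψ : Fin d × Fin d → ℂ}
    (hψ : enormSq ψ = 1) : G.pay A B ψ ≤ G.entVal := by
  refine le_csSup ⟨1, ?_⟩ ⟨d, A, B, ψ, hA, hB, hψ, rfl⟩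
  rintro x ⟨d, A, B, ψ, hA, hB, hψ, rfl⟩
  exact pay_le_one hA hB hψ

theorem IsStrategyB.opNorm_sqMat_le_entVal {B : G.V → G.B → Mat d} (hB : G.IsStrategyB B) :
    opNorm (G.sqMat B) ≤ G.entVal := by
  refine opNorm_le_of_braket_re_le hB.sqMat_posSemidef G.entVal_nonneg fun ψ hψ => ?_
  rcases isEmpty_or_nonempty G.A with h | h
  · rw [braket_sqMat_re]
    simpa using G.entVal_nonneg
  · obtain ⟨A, hA, hle⟩ := hB.exists_braket_sqMat_le_pay
    exact (hle ψ).trans (pay_le_entVal hA hB hψ)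

theorem IsStrategyB.sqrt_opNorm_sqMat_le_sqNorm {B : G.V → G.B → Mat d}
    (hB : G.IsStrategyB B) : Real.sqrt (opNorm (G.sqMat B)) ≤ G.sqNorm := by
  refine le_csSup ⟨Real.sqrt G.entVal, ?_⟩ ⟨d, B, hB, rfl⟩
  rintro x ⟨d, B, hB, rfl⟩
  exact Real.sqrt_le_sqrt hB.opNorm_sqMat_le_entVal

theorem sqNorm_nonneg : 0 ≤ G.sqNorm := by
  refine Real.sSup_nonneg ?_
  rintro x ⟨d, B, hB, rfl⟩
  exact Real.sqrt_nonneg _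

theorem entVal_le_sqNorm : G.entVal ≤ G.sqNorm := by
  refine Real.sSup_le ?_ sqNorm_nonneg
  rintro x ⟨d, A, B, ψ, hA, hB, hψ, rfl⟩
  exact (Real.le_sqrt_of_sq_le (pay_sq_le_opNorm_sqMat hA hψ)).trans
    hB.sqrt_opNorm_sqMat_le_sqNorm

theorem sqNorm_le_sqrt_entVal : G.sqNorm ≤ Real.sqrt G.entVal := by
  refine Real.sSup_le ?_ (Real.sqrt_nonneg _)
  rintro x ⟨d, B, hB, rfl⟩
  exact Real.sqrt_le_sqrt hB.opNorm_sqMat_le_entVal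

end ProjGame

/-- For any projection game `G`, `val*(G)² ≤ ‖G‖*² ≤ val*(G)`. -/
theorem entVal_sq_le_sqNorm_sq_le_entVal (G : ProjGame) :
    G.entVal ^ 2 ≤ G.sqNorm ^ 2 ∧ G.sqNorm ^ 2 ≤ G.entVal :=
  ⟨pow_le_pow_left₀ G.entVal_nonneg ProjGame.entVal_le_sqNorm 2,
    (pow_le_pow_left₀ ProjGame.sqNorm_nonneg ProjGame.sqNorm_le_sqrt_entVal 2).trans_eq
      (Real.sq_sqrt G.entVal_nonneg)⟩
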